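/- Let p ≥ 3 be a prime, r > p an integer with r ≡ 1 mod (p−1), such that r is not a power of p and Σ_p(r−1) > p−1. Then there is a short exact sequence of M-equivariant F_p-linear maps 0 → V_1 ⊗ D^{p−1} → X_{r−1} → V_{2p−1} → 0, i.e., there exist an injective M-equivariant linear map V_1 ⊗ D^{p−1} → X_{r−1} and a surjective M-equivariant linear map X_{r−1} → V_{2p−1} whose kernel is exactly the image of the first map. -/

import Mathlib

open MvPolynomial

/-- The action of a 2×2 matrix `g` over `F_p` on polynomials in two variables:
`((a b; c d) · F)(X, Y) = F (aX + cY, bX + dY)`. -/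
noncomputable def matAct (p : ℕ) (g : Matrix (Fin 2) (Fin 2) (ZMod p)) :
    MvPolynomial (Fin 2) (ZMod p) →ₐ[ZMod p] MvPolynomial (Fin 2) (ZMod p) :=
  aeval fun i => ∑ j, C (g j i) * X j

/-- The action of `g` twisted by the `n`-th power of the determinant character `D`. -/
noncomputable def twAct (p n : ℕ) (g : Matrix (Fin 2) (Fin 2) (ZMod p))
    (F : MvPolynomial (Fin 2) (ZMod p)) : MvPolynomial (Fin 2) (ZMod p) :=
  g.det ^ n • matAct p g F

/-- `V_m`: homogeneous polynomials of degree `m` in two variables over `F_p`. -/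
noncomputable def Vh (p m : ℕ) : Submodule (ZMod p) (MvPolynomial (Fin 2) (ZMod p)) :=
  homogeneousSubmodule (Fin 2) (ZMod p) m

/-- `X_r`: the `M`-submodule of `V_r` generated by `X^r`, realized as the span of the
orbit of `X^r` under the monoid `M = M_2(F_p)`. -/
noncomputable def XrSub (p r : ℕ) : Submodule (ZMod p) (MvPolynomial (Fin 2) (ZMod p)) :=
  Submodule.span (ZMod p)
    (Set.range fun g : Matrix (Fin 2) (Fin 2) (ZMod p) => matAct p g (X 0 ^ r))

/-- `X_{r-1}`: the `M`-submodule of `V_r` generated by `X^{r-1} Y`. -/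
noncomputable def Xr1Sub (p r : ℕ) : Submodule (ZMod p) (MvPolynomial (Fin 2) (ZMod p)) :=
  Submodule.span (ZMod p)
    (Set.range fun g : Matrix (Fin 2) (Fin 2) (ZMod p) => matAct p g (X 0 ^ (r - 1) * X 1))

/-- The special polynomial `θ = X^p Y − X Y^p`. -/
noncomputable def theta (p : ℕ) : MvPolynomial (Fin 2) (ZMod p) :=
  X 0 ^ p * X 1 - X 0 * X 1 ^ p

/-- `V_r^* = {F ∈ V_r : θ ∣ F}`. -/
noncomputable def Vstar (p r : ℕ) : Submodule (ZMod p) (MvPolynomial (Fin 2) (ZMod p)) :=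
  Vh p r ⊓ (Ideal.span {theta p}).restrictScalars (ZMod p)

/-- `V_r^{**} = {F ∈ V_r : θ² ∣ F}`. -/
noncomputable def Vdstar (p r : ℕ) : Submodule (ZMod p) (MvPolynomial (Fin 2) (ZMod p)) :=
  Vh p r ⊓ (Ideal.span {theta p ^ 2}).restrictScalars (ZMod p)

/-- `M`-equivariance of a linear map between two submodules of the polynomial ring,
where the source carries the action twisted by `D^{nA}` and the target by `D^{nB}`. -/
def EquivMap (p nA nB : ℕ)
    {A B : Submodule (ZMod p) (MvPolynomial (Fin 2) (ZMod p))}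
    (φ : A →ₗ[ZMod p] B) : Prop :=
  ∀ (g : Matrix (Fin 2) (Fin 2) (ZMod p)) (x y : A),
    (y : MvPolynomial (Fin 2) (ZMod p)) = twAct p nA g (x : MvPolynomial (Fin 2) (ZMod p)) →
    (φ y : MvPolynomial (Fin 2) (ZMod p)) = twAct p nB g (φ x : MvPolynomial (Fin 2) (ZMod p))

/-! ### Digit sums and binomial coefficients modulo `p` -/

lemma digits_sum_step {p : ℕ} (hp : 1 < p) (n : ℕ) :
    (Nat.digits p n).sum = n % p + (Nat.digits p (n / p)).sum := by
  rcases Nat.eq_zero_or_pos n with rfl | hn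
  · simp
  · rw [Nat.digits_def' hp hn, List.sum_cons]

lemma eq_zero_of_digits_sum_eq_zero {p : ℕ} (hp : 1 < p) (n : ℕ)
    (h : (Nat.digits p n).sum = 0) : n = 0 := by
  induction n using Nat.strong_induction_on with
  | _ n ih =>
    rcases Nat.eq_zero_or_pos n with rfl | hn
    · rfl
    · rw [digits_sum_step hp] at h
      have h0 := ih (n / p) (Nat.div_lt_self hn hp) (by omega)
      have := Nat.div_add_mod n p
      rw [h0] at this
      omega

lemma exists_eq_pow_of_digits_sum_eq_one {p : ℕ} (hp : 1 < p) (n : ℕ)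
    (h : (Nat.digits p n).sum = 1) : ∃ m, n = p ^ m := by
  induction n using Nat.strong_induction_on with
  | _ n ih =>
    rcases Nat.eq_zero_or_pos n with rfl | hn
    · simp at h
    · rw [digits_sum_step hp] at h
      have hdiv := Nat.div_add_mod n p
      by_cases h0 : n % p = 0
      · obtain ⟨m, hm⟩ := ih (n / p) (Nat.div_lt_self hn hp) (by omega)
        refine ⟨m + 1, ?_⟩
        rw [hm, h0] at hdiv
        rw [pow_succ', ← hdiv, add_zero]
      · have h1 := eq_zero_of_digits_sum_eq_zero hp (n / p) (by omega)
        rw [h1] at hdiv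
        exact ⟨0, by rw [pow_zero]; omega⟩

lemma not_dvd_choose_of_lt {p n k : ℕ} (hp : p.Prime) (hn : n < p) (hk : k ≤ n) :
    ¬ p ∣ n.choose k := by
  intro h
  have h1 : p ∣ n.factorial := by
    rw [← Nat.choose_mul_factorial_mul_factorial hk, mul_assoc]
    exact h.mul_right _
  exact absurd ((hp.dvd_factorial).1 h1) (by omega)

lemma exists_not_dvd_choose_of_le_digits_sum {p : ℕ} (hp : p.Prime) (n t : ℕ)
    (ht : t ≤ (Nat.digits p n).sum) :
    ∃ j ≤ n, (Nat.digits p j).sum = t ∧ ¬ p ∣ n.choose j := by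
  have : Fact p.Prime := ⟨hp⟩
  induction n using Nat.strong_induction_on generalizing t with
  | _ n ih =>
    rcases Nat.eq_zero_or_pos n with rfl | hn
    · simp only [Nat.digits_zero, List.sum_nil, Nat.le_zero] at ht
      exact ⟨0, le_rfl, by simp [ht], by simpa using hp.one_lt.ne'⟩
    · have hmod := Nat.mod_lt n hp.pos
      have hdiv := Nat.div_add_mod n p
      rw [digits_sum_step hp.one_lt] at ht
      obtain ⟨j', hj', hsum, hnd⟩ :=
        ih (n / p) (Nat.div_lt_self hn hp.one_lt) (t - n % p) (by omega)
      have hd : min t (n % p) < p := by omega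
      have hjm : (p * j' + min t (n % p)) % p = min t (n % p) := by
        rw [Nat.mul_add_mod, Nat.mod_eq_of_lt hd]
      have hjd : (p * j' + min t (n % p)) / p = j' := by
        rw [Nat.mul_add_div hp.pos, Nat.div_eq_of_lt hd, add_zero]
      refine ⟨p * j' + min t (n % p), ?_, ?_, ?_⟩
      · have := Nat.mul_le_mul_left p hj'
        omega
      · rw [digits_sum_step hp.one_lt, hjm, hjd, hsum]
        omega
      · rw [(Choose.choose_modEq_choose_mod_mul_choose_div_nat (p := p)).dvd_iff (dvd_refl p),
          hjm, hjd, hp.dvd_mul]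
        exact not_or.2 ⟨not_dvd_choose_of_lt hp hmod (min_le_right _ _), hnd⟩

lemma exists_sub_one_dvd_not_dvd_choose {p : ℕ} (hp : p.Prime) (hp3 : 3 ≤ p) {n : ℕ}
    (h : p - 1 < (Nat.digits p n).sum) :
    ∃ j, 0 < j ∧ j < n ∧ p - 1 ∣ j ∧ ¬ p ∣ n.choose j := by
  obtain ⟨j, hjn, hj, hnd⟩ := exists_not_dvd_choose_of_le_digits_sum hp n (p - 1) h.le
  refine ⟨j, Nat.pos_of_ne_zero ?_, lt_of_le_of_ne hjn ?_, ?_, hnd⟩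
  · rintro rfl
    simp at hj
    omega
  · rintro rfl
    omega
  · have hm : p % (p - 1) = 1 := by
      conv_lhs => rw [show p = (p - 1) + 1 by omega]
      rw [Nat.add_sub_cancel, Nat.add_mod_left, Nat.mod_eq_of_lt (by omega)]
    rw [(Nat.modEq_digits_sum (p - 1) p hm j).dvd_iff (dvd_refl _), hj]

lemma sub_one_lt_digits_sum {p : ℕ} (hp3 : 3 ≤ p) {r : ℕ}
    (hmod : r ≡ 1 [MOD p - 1]) (hr : 0 < r) (hnp : ∀ m : ℕ, r ≠ p ^ m) :
    p - 1 < (Nat.digits p r).sum := by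
  have hm : p % (p - 1) = 1 := by
    conv_lhs => rw [show p = (p - 1) + 1 by omega]
    rw [Nat.add_sub_cancel, Nat.add_mod_left, Nat.mod_eq_of_lt (by omega)]
  have h := (Nat.modEq_digits_sum (p - 1) p hm r).symm.trans hmod
  by_contra hlt
  have hs0 : (Nat.digits p r).sum ≠ 0 := fun h0 =>
    hr.ne' (eq_zero_of_digits_sum_eq_zero (by omega) r h0)
  have hs1 : (Nat.digits p r).sum ≠ 1 := fun h1 => by
    obtain ⟨m, hm⟩ := exists_eq_pow_of_digits_sum_eq_one (by omega) r h1
    exact hnp m hm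
  have hdvd := (Nat.modEq_iff_dvd' (by omega)).1 h.symm
  have := Nat.le_of_dvd (by omega) hdvd
  omega

/-! ### Power sums over `ZMod p` -/

lemma sum_zmod_pow {p : ℕ} [Fact p.Prime] {i : ℕ} (hi : 0 < i) :
    ∑ x : ZMod p, x ^ i = if p - 1 ∣ i then -1 else 0 := by
  classical
  let φ : (ZMod p)ˣ ↪ ZMod p := ⟨fun x => x, Units.val_injective⟩
  have hφ : Finset.univ.map φ = Finset.univ \ {0} := by
    ext x
    simpa only [Finset.mem_map, Finset.mem_univ, Function.Embedding.coeFn_mk, true_and,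
      Finset.mem_sdiff, Finset.mem_singleton, φ] using! isUnit_iff_ne_zero
  have h := FiniteField.sum_pow_units (ZMod p) i
  rw [ZMod.card] at h
  rw [← h, ← Finset.sum_sdiff ({0} : Finset (ZMod p)).subset_univ, Finset.sum_singleton,
    zero_pow hi.ne', add_zero, ← hφ, Finset.sum_map]
  rfl

/-! ### Linear forms and the matrix action -/

/-- The linear form `v 0 * X + v 1 * Y`. -/
noncomputable def linForm (p : ℕ) : (Fin 2 → ZMod p) →ₗ[ZMod p] MvPolynomial (Fin 2) (ZMod p) :=
  Fintype.linearCombination (ZMod p) X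

lemma linForm_apply (p : ℕ) (v : Fin 2 → ZMod p) :
    linForm p v = C (v 0) * X 0 + C (v 1) * X 1 := by
  simp [linForm, Fintype.linearCombination_apply, Fin.sum_univ_two, smul_eq_C_mul]

lemma linForm_single_zero (p : ℕ) : linForm p ![1, 0] = X 0 := by
  simp [linForm_apply]

lemma linForm_single_one (p : ℕ) : linForm p ![0, 1] = X 1 := by
  simp [linForm_apply]

lemma matAct_X (p : ℕ) (g : Matrix (Fin 2) (Fin 2) (ZMod p)) (i : Fin 2) :
    matAct p g (X i) = linForm p (fun j => g j i) := by
  simp [matAct, linForm_apply, Fin.sum_univ_two]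

lemma matAct_linForm (p : ℕ) (g : Matrix (Fin 2) (Fin 2) (ZMod p)) (v : Fin 2 → ZMod p) :
    matAct p g (linForm p v) = linForm p (g.mulVec v) := by
  rw [linForm_apply p v, map_add, map_mul, map_mul, matAct_X, matAct_X, ← algebraMap_eq,
    AlgHom.commutes, AlgHom.commutes]
  simp only [linForm_apply, algebraMap_eq, Matrix.mulVec, dotProduct, Fin.sum_univ_two, map_add,
    map_mul]
  ring

lemma matAct_matAct (p : ℕ) (g h : Matrix (Fin 2) (Fin 2) (ZMod p))
    (P : MvPolynomial (Fin 2) (ZMod p)) :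
    matAct p g (matAct p h P) = matAct p (g * h) P := by
  have : (matAct p g).comp (matAct p h) = matAct p (g * h) := by
    refine algHom_ext fun i => ?_
    rw [AlgHom.comp_apply, matAct_X, matAct_X, matAct_linForm]
    rfl
  rw [← this, AlgHom.comp_apply]

/-- The linear map from the monoid algebra of `M` given by the orbit of `X ^ N * Y`. -/
noncomputable def orbitMap (p N : ℕ) :
    (Matrix (Fin 2) (Fin 2) (ZMod p) →₀ ZMod p) →ₗ[ZMod p] MvPolynomial (Fin 2) (ZMod p) :=
  Finsupp.linearCombination (ZMod p) fun g => matAct p g (X 0 ^ N * X 1)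

lemma Xr1Sub_eq_range (p r : ℕ) : Xr1Sub p r = LinearMap.range (orbitMap p (r - 1)) := by
  rw [orbitMap, Finsupp.range_linearCombination, Xr1Sub]

lemma orbitMap_mapDomain (p N : ℕ) (g : Matrix (Fin 2) (Fin 2) (ZMod p))
    (f : Matrix (Fin 2) (Fin 2) (ZMod p) →₀ ZMod p) :
    orbitMap p N (f.mapDomain (g * ·)) = matAct p g (orbitMap p N f) := by
  induction f using Finsupp.induction_linear with
  | zero => simp
  | add f₁ f₂ h₁ h₂ => rw [Finsupp.mapDomain_add, map_add, h₁, h₂, map_add, map_add]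
  | single h a =>
    rw [Finsupp.mapDomain_single, orbitMap, Finsupp.linearCombination_single,
      Finsupp.linearCombination_single, map_smul, matAct_matAct]

lemma matAct_X_pow_mul_X (p N : ℕ) (g : Matrix (Fin 2) (Fin 2) (ZMod p)) :
    matAct p g (X 0 ^ N * X 1) =
      linForm p (fun j => g j 0) ^ N * linForm p (fun j => g j 1) := by
  rw [map_mul, map_pow, matAct_X, matAct_X]

lemma linForm_pow_mul_mem_Xr1Sub (p r : ℕ) (v w : Fin 2 → ZMod p) :
    linForm p v ^ (r - 1) * linForm p w ∈ Xr1Sub p r := by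
  refine Submodule.subset_span ⟨Matrix.of fun i j => (![v, w] : Fin 2 → _) j i, ?_⟩
  simp only [matAct_X_pow_mul_X]
  simp

lemma isHomogeneous_linForm (p : ℕ) (v : Fin 2 → ZMod p) : (linForm p v).IsHomogeneous 1 := by
  rw [linForm_apply]
  exact (by simpa using (isHomogeneous_C (Fin 2) (v 0)).mul (isHomogeneous_X (ZMod p) 0) :
    (C (v 0) * X 0 : MvPolynomial (Fin 2) (ZMod p)).IsHomogeneous 1).add
    (by simpa using (isHomogeneous_C (Fin 2) (v 1)).mul (isHomogeneous_X (ZMod p) 1))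

lemma Xr1Sub_le_Vh (p r : ℕ) (hr : 0 < r) : Xr1Sub p r ≤ Vh p r := by
  refine Submodule.span_le.2 ?_
  rintro _ ⟨g, rfl⟩
  have h := ((isHomogeneous_linForm p fun j => g j 0).pow (r - 1)).mul
    (isHomogeneous_linForm p fun j => g j 1)
  rw [one_mul, Nat.sub_add_cancel hr] at h
  simpa only [SetLike.mem_coe, Vh, mem_homogeneousSubmodule, matAct_X_pow_mul_X] using h

/-! ### The monomial basis of `Vh p m` -/

lemma X_pow_mul_X_pow_eq_monomial (p a b : ℕ) :
    (X 0 ^ a * X 1 ^ b : MvPolynomial (Fin 2) (ZMod p)) =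
      monomial (Finsupp.single 0 a + Finsupp.single 1 b) 1 := by
  rw [X_pow_eq_monomial, X_pow_eq_monomial, monomial_mul, one_mul]

lemma Vh_eq_span (p m : ℕ) :
    Vh p m = Submodule.span (ZMod p)
      (Set.range fun k : Fin (m + 1) =>
        (X 0 ^ (m - k) * X 1 ^ (k : ℕ) : MvPolynomial (Fin 2) (ZMod p))) := by
  refine le_antisymm ?_ (Submodule.span_le.2 ?_)
  · intro P hP
    rw [P.as_sum]
    refine Submodule.sum_mem _ fun d hd => ?_
    have hdeg : d 0 + d 1 = m := by
      have := (mem_homogeneousSubmodule m P).1 hP (mem_support_iff.1 hd)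
      rw [Finsupp.weight_apply, Finsupp.sum_fintype _ _ (by simp)] at this
      simpa [Fin.sum_univ_two] using this
    have hd' : d = Finsupp.single 0 (m - d 1) + Finsupp.single 1 (d 1) := by
      ext i
      fin_cases i
      · simp
        omega
      · simp
    have heq : monomial d (coeff d P) =
        coeff d P • (X 0 ^ (m - d 1) * X 1 ^ d 1 : MvPolynomial (Fin 2) (ZMod p)) := by
      rw [X_pow_mul_X_pow_eq_monomial, ← hd', smul_monomial, smul_eq_mul, mul_one]
    rw [heq]
    exact Submodule.smul_mem _ _ (Submodule.subset_span ⟨⟨d 1, by omega⟩, rfl⟩)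
  · rintro _ ⟨k, rfl⟩
    have h := (isHomogeneous_X_pow (R := ZMod p) (0 : Fin 2) (m - k)).mul
      (isHomogeneous_X_pow (R := ZMod p) (1 : Fin 2) k)
    rwa [Nat.sub_add_cancel (by omega)] at h

lemma finrank_Vh (p m : ℕ) [Fact p.Prime] : Module.finrank (ZMod p) (Vh p m) = m + 1 := by
  rw [Vh_eq_span, finrank_span_eq_card, Fintype.card_fin]
  have h := (basisMonomials (Fin 2) (ZMod p)).linearIndependent.comp
    (fun k : Fin (m + 1) => Finsupp.single 0 (m - (k : ℕ)) + Finsupp.single 1 (k : ℕ))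
    (fun a b hab => by
      have := DFunLike.congr_fun hab 1
      simp at this
      exact Fin.ext this)
  simpa only [Function.comp_def, coe_basisMonomials, ← X_pow_mul_X_pow_eq_monomial] using h

instance finite_Vh (p m : ℕ) : Module.Finite (ZMod p) (Vh p m) := by
  rw [Vh_eq_span]
  exact Module.Finite.span_of_finite _ (Set.finite_range _)

/-! ### The sum over lines and its injectivity -/

/-- Representatives of the points of the projective line over `F_p`. -/
def linePoint (p : ℕ) : Option (ZMod p) → Fin 2 → ZMod p
  | none => ![0, 1]
  | some c => ![1, c]

/-- The map sending a family of linear forms `ℓ_L`, indexed by the projective line, to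
`∑ L ^ N * ℓ_L`. -/
noncomputable def lineMap (p N : ℕ) [Fact p.Prime] :
    (Option (ZMod p) → Fin 2 → ZMod p) →ₗ[ZMod p] MvPolynomial (Fin 2) (ZMod p) :=
  ∑ o, LinearMap.mulLeft (ZMod p) (linForm p (linePoint p o) ^ N) ∘ₗ linForm p ∘ₗ LinearMap.proj o

lemma lineMap_apply (p N : ℕ) [Fact p.Prime] (x : Option (ZMod p) → Fin 2 → ZMod p) :
    lineMap p N x = ∑ o, linForm p (linePoint p o) ^ N * linForm p (x o) := by
  simp [lineMap]

lemma lineMap_single (p N : ℕ) [Fact p.Prime] (o : Option (ZMod p)) (w : Fin 2 → ZMod p) :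
    lineMap p N (Pi.single o w) = linForm p (linePoint p o) ^ N * linForm p w := by
  rw [lineMap_apply, Finset.sum_eq_single o]
  · rw [Pi.single_eq_same]
  · intro b _ hb
    rw [Pi.single_eq_of_ne hb, map_zero, mul_zero]
  · simp

lemma pow_eq_one_of_sub_one_dvd {p N : ℕ} [Fact p.Prime] (hN : p - 1 ∣ N) {a : ZMod p}
    (ha : a ≠ 0) : a ^ N = 1 := by
  obtain ⟨k, rfl⟩ := hN
  rw [pow_mul, ZMod.pow_card_sub_one_eq_one ha, one_pow]

lemma linForm_smul_pow {p N : ℕ} [Fact p.Prime] (hN : p - 1 ∣ N) {a : ZMod p}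
    (ha : a ≠ 0) (v : Fin 2 → ZMod p) : linForm p (a • v) ^ N = linForm p v ^ N := by
  rw [map_smul, smul_pow, pow_eq_one_of_sub_one_dvd hN ha, one_smul]

lemma exists_lineMap_eq_linForm_pow_mul {p : ℕ} [Fact p.Prime] (v w : Fin 2 → ZMod p) :
    ∃ x, ∀ N, 0 < N → p - 1 ∣ N → linForm p v ^ N * linForm p w = lineMap p N x := by
  by_cases h0 : v 0 = 0
  · by_cases h1 : v 1 = 0
    · refine ⟨0, fun N hN _ => ?_⟩
      have : v = 0 := by ext i; fin_cases i <;> simpa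
      rw [this, map_zero, map_zero, zero_pow hN.ne', zero_mul]
    · refine ⟨Pi.single none w, fun N _ hN => ?_⟩
      have : v = v 1 • linePoint p none := by ext i; fin_cases i <;> simp [linePoint, h0]
      rw [lineMap_single, this, linForm_smul_pow hN h1]
  · refine ⟨Pi.single (some (v 1 / v 0)) w, fun N _ hN => ?_⟩
    have : v = v 0 • linePoint p (some (v 1 / v 0)) := by
      ext i; fin_cases i <;> simp [linePoint, mul_div_cancel₀, h0]
    rw [lineMap_single]
    conv_lhs => rw [this, linForm_smul_pow hN h0]

lemma exists_lineMap_eq_orbitMap {p : ℕ} [Fact p.Prime]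
    (f : Matrix (Fin 2) (Fin 2) (ZMod p) →₀ ZMod p) :
    ∃ x, ∀ N, 0 < N → p - 1 ∣ N → orbitMap p N f = lineMap p N x := by
  induction f using Finsupp.induction_linear with
  | zero => exact ⟨0, fun N _ _ => by simp⟩
  | add f₁ f₂ h₁ h₂ =>
    obtain ⟨x₁, h₁⟩ := h₁
    obtain ⟨x₂, h₂⟩ := h₂
    exact ⟨x₁ + x₂, fun N h h' => by rw [map_add, map_add, h₁ N h h', h₂ N h h']⟩
  | single g a =>
    obtain ⟨x, hx⟩ :=
      exists_lineMap_eq_linForm_pow_mul (fun j => g j 0) (fun j => g j 1)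
    refine ⟨a • x, fun N h h' => ?_⟩
    rw [orbitMap, Finsupp.linearCombination_single, matAct_X_pow_mul_X, map_smul, hx N h h']

/-- The action of the unipotent matrix `X ↦ X + Y`, `Y ↦ Y` on families of linear forms. -/
def unipShift (p : ℕ) : Module.End (ZMod p) (Option (ZMod p) → Fin 2 → ZMod p) :=
  LinearMap.pi fun o => Matrix.mulVecLin !![1, 0; 1, 1] ∘ₗ LinearMap.proj (o.map (· - 1))

lemma unipShift_apply (p : ℕ) (x : Option (ZMod p) → Fin 2 → ZMod p) (o : Option (ZMod p)) :
    unipShift p x o = (!![1, 0; 1, 1] : Matrix _ _ (ZMod p)).mulVec (x (o.map (· - 1))) := rfl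

lemma unipShift_pow_apply (p k : ℕ) (x : Option (ZMod p) → Fin 2 → ZMod p)
    (o : Option (ZMod p)) :
    (unipShift p ^ k) x o =
      (!![1, 0; (k : ZMod p), 1] : Matrix _ _ (ZMod p)).mulVec (x (o.map (· - (k : ZMod p)))) := by
  induction k generalizing o with
  | zero => simp [← Matrix.one_fin_two]
  | succ k ih =>
    rw [pow_succ', Module.End.mul_apply, unipShift_apply, ih, Matrix.mulVec_mulVec, Option.map_map]
    congr 1
    · simp [add_comm]
    · congr 2
      ext c
      simp [sub_sub, add_comm]

lemma unipShift_pow_self (p : ℕ) : unipShift p ^ p = 1 := by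
  refine LinearMap.ext fun x => funext fun o => ?_
  rw [unipShift_pow_apply]
  simp [← Matrix.one_fin_two]

lemma lineMap_unipShift (p N : ℕ) [Fact p.Prime] (x : Option (ZMod p) → Fin 2 → ZMod p) :
    lineMap p N (unipShift p x) = matAct p !![1, 0; 1, 1] (lineMap p N x) := by
  rw [lineMap_apply, lineMap_apply, map_sum,
    ← (Equiv.optionCongr (Equiv.addRight (1 : ZMod p))).sum_comp]
  refine Finset.sum_congr rfl fun o _ => ?_
  rw [map_mul, map_pow, matAct_linForm, matAct_linForm, unipShift_apply]
  congr 2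
  · congr 1
    ext i
    cases o <;> fin_cases i <;> simp [linePoint, Matrix.mulVec, dotProduct, add_comm]
  · cases o <;> simp

lemma exists_unipShift_fixed {p : ℕ} [Fact p.Prime]
    (K : Submodule (ZMod p) (Option (ZMod p) → Fin 2 → ZMod p))
    (hK : ∀ x ∈ K, unipShift p x ∈ K) (hne : K ≠ ⊥) :
    ∃ x ∈ K, x ≠ 0 ∧ unipShift p x = x := by
  have : CharP (Module.End (ZMod p) (Option (ZMod p) → Fin 2 → ZMod p)) p :=
    charP_of_injective_algebraMap (algebraMap (ZMod p) _).injective p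
  obtain ⟨x, hx, hx0⟩ := Submodule.exists_mem_ne_zero_of_ne_bot hne
  have hnil : (unipShift p - 1) ^ p = 0 := by
    rw [sub_pow_char_of_commute p (Commute.one_right _), unipShift_pow_self, one_pow, sub_self]
  have hstab : ∀ k, ((unipShift p - 1) ^ k : Module.End _ _) x ∈ K := by
    intro k
    induction k with
    | zero => simpa
    | succ k ih =>
      rw [pow_succ', Module.End.mul_apply]
      exact K.sub_mem (hK _ ih) ih
  have hex : ∃ k, ((unipShift p - 1) ^ k : Module.End _ _) x = 0 := ⟨p, by rw [hnil]; rfl⟩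
  classical
  have hmin := Nat.find_spec hex
  obtain ⟨k, hk⟩ : ∃ k, Nat.find hex = k + 1 := by
    refine Nat.exists_eq_succ_of_ne_zero fun h => hx0 ?_
    rwa [h] at hmin
  refine ⟨((unipShift p - 1) ^ k : Module.End _ _) x, hstab k, Nat.find_min hex (by omega), ?_⟩
  rw [hk, pow_succ', Module.End.mul_apply] at hmin
  exact sub_eq_zero.1 hmin

lemma coeff_sum_one_add_C_mul_X_pow {p : ℕ} [Fact p.Prime] (M j : ℕ) :
    (∑ c : ZMod p, (1 + Polynomial.C c * Polynomial.X) ^ M).coeff j =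
      M.choose j * ∑ c : ZMod p, c ^ j := by
  rw [Polynomial.finsetSum_coeff, Finset.mul_sum]
  refine Finset.sum_congr rfl fun c _ => ?_
  have : (1 + Polynomial.C c * Polynomial.X) ^ M =
      ((1 + Polynomial.X) ^ M : Polynomial (ZMod p)).comp (Polynomial.C c * Polynomial.X) := by
    simp
  rw [this, Polynomial.comp_C_mul_X_coeff, Polynomial.coeff_one_add_X_pow]

lemma aeval_linForm (p : ℕ) (v : Fin 2 → ZMod p) :
    aeval ![1, Polynomial.X] (linForm p v) =
      Polynomial.C (v 0) + Polynomial.C (v 1) * Polynomial.X := by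
  simp [linForm_apply, Polynomial.algebraMap_eq]

lemma fixed_eq_of_unipShift {p : ℕ} [Fact p.Prime] {x : Option (ZMod p) → Fin 2 → ZMod p}
    (hx : unipShift p x = x) :
    x none 0 = 0 ∧ ∀ c, x (some c) 0 = x (some 0) 0 ∧
      x (some c) 1 = x (some 0) 1 + c * x (some 0) 0 := by
  have h : ∀ o, x o 0 = x (o.map (· - 1)) 0 ∧
      x o 1 = x (o.map (· - 1)) 0 + x (o.map (· - 1)) 1 := by
    intro o
    have ho : unipShift p x o = x o := congrFun hx o
    rw [unipShift_apply] at ho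
    constructor
    · conv_lhs => rw [← ho]
      simp [Matrix.mulVec, dotProduct]
    · conv_lhs => rw [← ho]
      simp [Matrix.mulVec, dotProduct]
  refine ⟨by simpa using (h none).2, fun c => ?_⟩
  have hn : ∀ n : ℕ, x (some (n : ZMod p)) 0 = x (some 0) 0 ∧
      x (some (n : ZMod p)) 1 = x (some 0) 1 + n * x (some 0) 0 := by
    intro n
    induction n with
    | zero => simp
    | succ n ih =>
      have := h (some ((n + 1 : ℕ) : ZMod p))
      simp only [Option.map_some, Nat.cast_add, Nat.cast_one, add_sub_cancel_right] at this
      rw [ih.1, ih.2] at this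
      push_cast
      exact ⟨this.1, by rw [this.2]; ring⟩
  have := hn c.val
  rwa [ZMod.natCast_zmod_val] at this

lemma lineMap_injective {p N : ℕ} [hp : Fact p.Prime] (hp3 : 3 ≤ p)
    (h₁ : ∃ j, 0 < j ∧ j < N + 1 ∧ p - 1 ∣ j ∧ ¬ p ∣ (N + 1).choose j)
    (h₂ : ∃ j, 0 < j ∧ j < N ∧ p - 1 ∣ j ∧ ¬ p ∣ N.choose j) :
    Function.Injective (lineMap p N) := by
  rw [← LinearMap.ker_eq_bot]
  by_contra hne
  obtain ⟨x, hx, hx0, hfix⟩ := exists_unipShift_fixed _ (fun x hx => by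
    rw [LinearMap.mem_ker] at hx ⊢
    rw [lineMap_unipShift, hx, map_zero]) hne
  obtain ⟨hnone, hsome⟩ := fixed_eq_of_unipShift hfix
  set α := x (some 0) 0
  set β := x (some 0) 1
  set γ := x none 1 with hγ
  have hpoly : Polynomial.C α * ∑ c : ZMod p, (1 + Polynomial.C c * Polynomial.X) ^ (N + 1) +
      Polynomial.C β * ((∑ c : ZMod p, (1 + Polynomial.C c * Polynomial.X) ^ N) * Polynomial.X) +
      Polynomial.C γ * Polynomial.X ^ (N + 1) = 0 := by
    have h := congrArg (aeval ![1, (Polynomial.X : Polynomial (ZMod p))]) (LinearMap.mem_ker.1 hx)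
    rw [lineMap_apply, map_zero, map_sum, Fintype.sum_option] at h
    simp only [map_mul, map_pow, aeval_linForm, linePoint, hnone, (hsome _).1, (hsome _).2] at h
    rw [← h, Finset.mul_sum, Finset.sum_mul, Finset.mul_sum, ← Finset.sum_add_distrib, add_comm]
    congr 1
    · simp
      ring
    · refine Finset.sum_congr rfl fun c _ => ?_
      simp
      ring
  have hcoeff : ∀ j, α * ((N + 1).choose (j + 1) * ∑ c : ZMod p, c ^ (j + 1)) +
      β * (N.choose j * ∑ c : ZMod p, c ^ j) + (if j = N then γ else 0) = 0 := by
    intro j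
    have h := congrArg (Polynomial.coeff · (j + 1)) hpoly
    simpa only [Polynomial.coeff_add, Polynomial.coeff_C_mul, Polynomial.coeff_mul_X,
      coeff_sum_one_add_C_mul_X_pow, Polynomial.coeff_zero, Polynomial.coeff_X_pow,
      mul_ite, mul_one, mul_zero, add_left_inj] using h
  have hα : α = 0 := by
    obtain ⟨j, hj0, hjN, hdvd, hnd⟩ := h₁
    obtain ⟨i, rfl⟩ := Nat.exists_eq_succ_of_ne_zero hj0.ne'
    have hi := Nat.le_of_dvd hj0 hdvd
    have hndvd : ¬ p - 1 ∣ i := fun h => by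
      have := (Nat.dvd_add_right h).1 (show p - 1 ∣ i + 1 from hdvd)
      have := Nat.le_of_dvd one_pos this
      omega
    have h := hcoeff i
    rw [sum_zmod_pow (by omega), sum_zmod_pow (by omega), if_pos hdvd, if_neg hndvd,
      if_neg (by omega)] at h
    rw [← ZMod.natCast_eq_zero_iff] at hnd
    simpa [hnd] using h
  have hβ : β = 0 := by
    obtain ⟨j, hj0, hjN, hdvd, hnd⟩ := h₂
    have h := hcoeff j
    rw [hα, zero_mul, zero_add, sum_zmod_pow hj0, if_pos hdvd, if_neg (by omega)] at h
    rw [← ZMod.natCast_eq_zero_iff] at hnd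
    simpa [hnd] using h
  have hγ0 : γ = 0 := by
    have h := hcoeff N
    simpa [hα, hβ] using h
  refine hx0 (funext fun o => funext fun i => ?_)
  cases o with
  | none => fin_cases i <;> simp [hnone, ← hγ, hγ0]
  | some c => fin_cases i <;> simp [hsome c, hα, hβ]

/-! ### The invariant sum `∑ L ^ N` -/

/-- The sum of `L ^ N` over all linear forms `L`. -/
noncomputable def linFormSum (p N : ℕ) [Fact p.Prime] : MvPolynomial (Fin 2) (ZMod p) :=
  ∑ v : Fin 2 → ZMod p, linForm p v ^ N

lemma exists_orbitMap_eq_linFormSum_mul (p : ℕ) [Fact p.Prime]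
    {P : MvPolynomial (Fin 2) (ZMod p)} (hP : P ∈ Vh p 1) :
    ∃ f, ∀ N, orbitMap p N f = linFormSum p N * P := by
  rw [Vh_eq_span] at hP
  induction hP using Submodule.span_induction with
  | zero => exact ⟨0, fun N => by simp⟩
  | add a b _ _ ha hb =>
    obtain ⟨f, hf⟩ := ha
    obtain ⟨f', hf'⟩ := hb
    exact ⟨f + f', fun N => by rw [map_add, hf, hf', mul_add]⟩
  | smul c a _ ha =>
    obtain ⟨f, hf⟩ := ha
    exact ⟨c • f, fun N => by rw [map_smul, hf, mul_smul_comm]⟩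
  | mem a ha =>
    obtain ⟨k, rfl⟩ := ha
    have h : ∀ w, ∃ f, ∀ N, orbitMap p N f = linFormSum p N * linForm p w := fun w =>
      ⟨∑ v, Finsupp.single (Matrix.of fun i j => (![v, w] : Fin 2 → _) j i) 1, fun N => by
        simp [orbitMap, linFormSum, matAct_X, Finset.sum_mul]⟩
    fin_cases k
    · simpa [linForm_single_zero] using h ![1, 0]
    · simpa [linForm_single_one] using h ![0, 1]

lemma matAct_linFormSum_of_det_ne_zero {p : ℕ} [Fact p.Prime] (N : ℕ)
    {g : Matrix (Fin 2) (Fin 2) (ZMod p)} (hg : g.det ≠ 0) :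
    matAct p g (linFormSum p N) = linFormSum p N := by
  rw [linFormSum, map_sum]
  simp only [map_pow, matAct_linForm]
  have hinj : Function.Injective g.mulVec :=
    Matrix.mulVec_injective_of_isUnit ((Matrix.isUnit_iff_isUnit_det g).2 hg.isUnit)
  exact (Finite.injective_iff_bijective.1 hinj).sum_comp fun v => linForm p v ^ N

lemma sum_linear_combination_eq_zero {p : ℕ} [Fact p.Prime] {A V : Type*} [AddCommGroup A]
    [Module (ZMod p) A] [AddCommGroup V] [Module (ZMod p) V] (F : V → A) (e : V) (t : ZMod p) :
    ∑ c : ZMod p, ∑ a : ZMod p, F (a • e + c • t • e) = 0 := by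
  have h : ∀ c : ZMod p, ∑ a : ZMod p, F (a • e + c • t • e) = ∑ a : ZMod p, F (a • e) := by
    intro c
    rw [← Equiv.sum_comp (Equiv.addRight (c * t)) fun a => F (a • e)]
    refine Finset.sum_congr rfl fun a _ => ?_
    rw [Equiv.coe_addRight, add_smul, mul_smul]
  rw [Finset.sum_congr rfl fun c _ => h c, Finset.sum_const, Finset.card_univ, ZMod.card,
    ← Nat.cast_smul_eq_nsmul (ZMod p), ZMod.natCast_self, zero_smul]

lemma matAct_linFormSum_of_det_eq_zero {p : ℕ} [Fact p.Prime] (N : ℕ)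
    {g : Matrix (Fin 2) (Fin 2) (ZMod p)} (hg : g.det = 0) :
    matAct p g (linFormSum p N) = 0 := by
  have hsum : matAct p g (linFormSum p N) =
      ∑ c : ZMod p, ∑ a : ZMod p, linForm p (a • g.col 0 + c • g.col 1) ^ N := by
    rw [linFormSum, map_sum, ← (finTwoArrowEquiv (ZMod p)).symm.sum_comp,
      Fintype.sum_prod_type_right]
    refine Finset.sum_congr rfl fun c _ => Finset.sum_congr rfl fun a _ => ?_
    rw [map_pow, matAct_linForm]
    congr 2
    ext i
    simp [Matrix.mulVec, dotProduct, mul_comm]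
  rw [Matrix.det_fin_two] at hg
  rw [hsum]
  by_cases h0 : g.col 0 = 0
  · rw [Finset.sum_comm]
    have h := sum_linear_combination_eq_zero (p := p) (fun v => linForm p v ^ N) (g.col 1) 0
    simp only [zero_smul, smul_zero, add_zero] at h
    simpa only [h0, smul_zero, zero_add] using h
  · obtain ⟨t, ht⟩ : ∃ t : ZMod p, g.col 1 = t • g.col 0 := by
      by_cases h00 : g 0 0 = 0
      · have h10 : g 1 0 ≠ 0 := fun h => h0 (by ext i; fin_cases i <;> simpa)
        refine ⟨g 1 1 / g 1 0, ?_⟩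
        have h01 : g 0 1 = 0 := by simpa [h00, h10] using hg
        ext i
        fin_cases i <;> simp [h00, h01, h10]
      · refine ⟨g 0 1 / g 0 0, ?_⟩
        ext i
        fin_cases i
        · simp [h00]
        · simp only [Matrix.col_apply, Pi.smul_apply, smul_eq_mul, Fin.mk_one]
          field_simp
          linear_combination hg
    rw [ht]
    exact sum_linear_combination_eq_zero (fun v => linForm p v ^ N) (g.col 0) t

lemma linFormSum_eq_sum (p N : ℕ) [Fact p.Prime] :
    linFormSum p N = ∑ m ∈ Finset.range (N + 1),
      C ((∑ a : ZMod p, a ^ m) * (∑ c : ZMod p, c ^ (N - m)) * (N.choose m : ZMod p)) *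
        (X 0 ^ m * X 1 ^ (N - m)) := by
  rw [linFormSum, ← (finTwoArrowEquiv (ZMod p)).symm.sum_comp, Fintype.sum_prod_type]
  simp only [linForm_apply, finTwoArrowEquiv_symm_apply, Matrix.cons_val_zero, Matrix.cons_val_one,
    add_pow, mul_pow]
  rw [Finset.sum_congr rfl fun a _ => Finset.sum_comm, Finset.sum_comm]
  refine Finset.sum_congr rfl fun m _ => ?_
  rw [Finset.sum_mul_sum, Finset.sum_mul, map_sum, Finset.sum_mul]
  refine Finset.sum_congr rfl fun a _ => ?_
  rw [Finset.sum_mul, map_sum, Finset.sum_mul]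
  refine Finset.sum_congr rfl fun c _ => ?_
  simp only [map_mul, map_pow, map_natCast]
  ring

lemma linFormSum_two_mul_sub_two {p : ℕ} [hp : Fact p.Prime] (hp3 : 3 ≤ p) :
    linFormSum p (2 * p - 2) = 0 := by
  rw [linFormSum_eq_sum]
  refine Finset.sum_eq_zero fun m hm => ?_
  rw [Finset.mem_range] at hm
  rcases Nat.eq_zero_or_pos m with rfl | hm0
  · simp
  rcases Nat.eq_zero_or_pos (2 * p - 2 - m) with h0 | hm1
  · simp [h0]
  rw [sum_zmod_pow hm0]
  split_ifs with hdvd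
  · obtain ⟨k, rfl⟩ := hdvd
    have hk : k = 1 := by
      have h1 : k ≠ 0 := by rintro rfl; simp at hm0
      have h2 : k < 2 := by
        by_contra hk
        have := Nat.mul_le_mul_left (p - 1) (not_lt.1 hk)
        omega
      omega
    subst hk
    have h : p ∣ (2 * p - 2).choose ((p - 1) * 1) :=
      hp.out.dvd_choose (by omega) (by omega) (by omega)
    rw [(ZMod.natCast_eq_zero_iff _ _).2 h]
    simp
  · simp

lemma linFormSum_ne_zero {p N : ℕ} [hp : Fact p.Prime] (hN : p - 1 ∣ N)
    (h : ∃ j, 0 < j ∧ j < N ∧ p - 1 ∣ j ∧ ¬ p ∣ N.choose j) : linFormSum p N ≠ 0 := by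
  obtain ⟨j, hj0, hjN, hdvd, hnd⟩ := h
  intro h0
  have h1 := congrArg (coeff (Finsupp.single 0 j + Finsupp.single 1 (N - j))) h0
  rw [linFormSum_eq_sum, coeff_sum, Finset.sum_eq_single j] at h1
  · rw [X_pow_mul_X_pow_eq_monomial, coeff_C_mul, coeff_monomial, if_pos rfl,
      sum_zmod_pow hj0, sum_zmod_pow (by omega), if_pos hdvd, if_pos (Nat.dvd_sub hN hdvd)] at h1
    rw [← ZMod.natCast_eq_zero_iff] at hnd
    simp [hnd] at h1
  · intro b _ hb
    rw [X_pow_mul_X_pow_eq_monomial, coeff_C_mul, coeff_monomial, if_neg, mul_zero]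
    intro heq
    have := DFunLike.congr_fun heq 0
    simp at this
    exact hb this
  · intro hj
    simp at hj
    omega

/-! ### The case `r = 2 * p - 1` -/

lemma choose_two_mul_sub_two {p : ℕ} [hp : Fact p.Prime] {k : ℕ} (hk : k < p) :
    ((2 * p - 2).choose k : ZMod p) = (-1) ^ k * (k + 1) := by
  induction k with
  | zero => simp
  | succ k ih =>
    have h := congrArg (Nat.cast : ℕ → ZMod p) (Nat.choose_succ_right_eq (2 * p - 2) k)
    rw [Nat.cast_mul, Nat.cast_mul, ih (by omega), Nat.sub_sub, Nat.cast_sub (by omega)] at h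
    have hk0 : ((k + 1 : ℕ) : ZMod p) ≠ 0 := fun h0 => by
      have := Nat.le_of_dvd (by omega) ((ZMod.natCast_eq_zero_iff _ _).1 h0)
      omega
    refine mul_right_cancel₀ hk0 (h.trans ?_)
    push_cast
    rw [ZMod.natCast_self]
    ring

lemma choose_two_mul_sub_two_add {p : ℕ} [hp : Fact p.Prime] {k : ℕ} (hk : k + 1 ≤ p) :
    ((2 * p - 2).choose (k + p - 1) : ZMod p) = (-1) ^ (p + k) * k := by
  have h2 := hp.out.two_le
  rw [← Nat.choose_symm (by omega), show 2 * p - 2 - (k + p - 1) = p - 1 - k by omega,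
    choose_two_mul_sub_two (by omega), Nat.sub_sub, Nat.cast_sub (by omega)]
  have hs : (-1 : ZMod p) ^ (p - (1 + k)) = -(-1) ^ (p + k) := by
    have : p + k = (p - (1 + k)) + 1 + 2 * k := by omega
    rw [this, pow_add _ _ (2 * k), pow_mul, pow_succ]
    simp
  rw [hs]
  push_cast
  rw [ZMod.natCast_self]
  ring

/-- The part of `(X + Y) ^ (2 * p - 2)` where the exponent of `Y` is `k` or `k + p - 1`. -/
noncomputable def binomialPart (p k : ℕ) : MvPolynomial (Fin 2) (ZMod p) :=
  ((2 * p - 2).choose k : ZMod p) • (X 0 ^ (2 * p - 2 - k) * X 1 ^ k) +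
    ((2 * p - 2).choose (k + p - 1) : ZMod p) • (X 0 ^ (p - 1 - k) * X 1 ^ (k + p - 1))

lemma sum_pow_smul_linForm_pow {p : ℕ} [hp : Fact p.Prime] {k : ℕ} (hk0 : 0 < k)
    (hk : k < p - 1) :
    ∑ c : ZMod p, c ^ (p - 1 - k) • linForm p ![1, c] ^ (2 * p - 2) = -binomialPart p k := by
  have h : ∀ c : ZMod p, c ^ (p - 1 - k) • linForm p ![1, c] ^ (2 * p - 2) =
      ∑ m ∈ Finset.range (2 * p - 2 + 1), (c ^ (p - 1 - k + m) * ((2 * p - 2).choose m : ZMod p)) •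
        (X 0 ^ (2 * p - 2 - m) * X 1 ^ m : MvPolynomial (Fin 2) (ZMod p)) := by
    intro c
    rw [linForm_apply, add_comm, add_pow, Finset.smul_sum]
    refine Finset.sum_congr rfl fun m _ => ?_
    simp only [smul_eq_C_mul, Matrix.cons_val_zero, Matrix.cons_val_one, map_mul, map_pow,
      map_natCast, map_one]
    ring
  rw [Finset.sum_congr rfl fun c _ => h c, Finset.sum_comm]
  simp only [← Finset.sum_smul, ← Finset.sum_mul]
  rw [Finset.sum_congr rfl fun m _ => by rw [sum_zmod_pow (by omega : 0 < p - 1 - k + m)],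
    Finset.sum_eq_add_of_mem k (k + p - 1) (by simp; omega) (by simp; omega) (by omega)]
  · rw [if_pos ⟨1, by omega⟩, if_pos ⟨2, by omega⟩, binomialPart,
      show 2 * p - 2 - (k + p - 1) = p - 1 - k by omega, neg_add]
    simp only [neg_mul, one_mul, neg_smul]
  · rintro m hm ⟨hmk, hmk'⟩
    rw [Finset.mem_range] at hm
    rw [if_neg, zero_mul, zero_smul]
    rintro ⟨q, hq⟩
    have hq3 : q < 3 := by
      by_contra hq3
      have := Nat.mul_le_mul_left (p - 1) (not_lt.1 hq3)
      omega
    interval_cases q <;> omega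

lemma binomialPart_mul_linForm_mem {p : ℕ} [hp : Fact p.Prime] {k : ℕ} (hk : k ≤ p - 1)
    (w : Fin 2 → ZMod p) : binomialPart p k * linForm p w ∈ Xr1Sub p (2 * p - 1) := by
  have h2 := hp.out.two_le
  have hmem : ∀ v, linForm p v ^ (2 * p - 2) * linForm p w ∈ Xr1Sub p (2 * p - 1) :=
    fun v => linForm_pow_mul_mem_Xr1Sub p (2 * p - 1) v w
  rcases Nat.eq_zero_or_pos k with rfl | hk0
  · have h : binomialPart p 0 = linForm p ![1, 0] ^ (2 * p - 2) := by
      rw [binomialPart, choose_two_mul_sub_two_add (by omega), linForm_single_zero]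
      simp
    rw [h]
    exact hmem _
  rcases hk.eq_or_lt with rfl | hk1
  · have h : binomialPart p (p - 1) = linForm p ![0, 1] ^ (2 * p - 2) := by
      rw [binomialPart, choose_two_mul_sub_two (by omega), linForm_single_one,
        show p - 1 + p - 1 = 2 * p - 2 by omega, Nat.cast_sub (by omega)]
      simp
    rw [h]
    exact hmem _
  · rw [← neg_mem_iff, ← neg_mul, ← sum_pow_smul_linForm_pow hk0 hk1, Finset.sum_mul]
    refine Submodule.sum_mem _ fun c _ => ?_
    rw [smul_mul_assoc]
    exact Submodule.smul_mem _ _ (hmem _)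

lemma mem_and_mem_of_det_eq_neg_one {R V : Type*} [CommRing R] [AddCommGroup V] [Module R V]
    (S : Submodule R V) {a b c d : R} {x y : V} (hdet : a * d - b * c = -1)
    (h₁ : a • x + b • y ∈ S) (h₂ : c • x + d • y ∈ S) : x ∈ S ∧ y ∈ S := by
  constructor
  · have h := S.sub_mem (S.smul_mem b h₂) (S.smul_mem d h₁)
    have hx : b • (c • x + d • y) - d • (a • x + b • y) = x := by
      rw [show b • (c • x + d • y) - d • (a • x + b • y) = (-(a * d - b * c)) • x by module,
        hdet, neg_neg, one_smul]
    rwa [hx] at h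
  · have h := S.sub_mem (S.smul_mem c h₁) (S.smul_mem a h₂)
    have hy : c • (a • x + b • y) - a • (c • x + d • y) = y := by
      rw [show c • (a • x + b • y) - a • (c • x + d • y) = (-(a * d - b * c)) • y by module,
        hdet, neg_neg, one_smul]
    rwa [hy] at h

lemma X_pow_mul_X_pow_mem_Xr1Sub {p : ℕ} [hp : Fact p.Prime] {k : ℕ} (hk0 : 0 < k)
    (hk : k ≤ p - 1) :
    X 0 ^ (2 * p - 1 - k) * X 1 ^ k ∈ Xr1Sub p (2 * p - 1) ∧
      X 0 ^ (p - k) * X 1 ^ (k + p - 1) ∈ Xr1Sub p (2 * p - 1) := by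
  have h2 := hp.out.two_le
  obtain ⟨i, rfl⟩ := Nat.exists_eq_add_of_lt hk0
  rw [zero_add] at *
  have h₁ := binomialPart_mul_linForm_mem (p := p) hk ![1, 0]
  have h₂ := binomialPart_mul_linForm_mem (p := p) (k := i) (by omega) ![0, 1]
  refine mem_and_mem_of_det_eq_neg_one (Xr1Sub p (2 * p - 1))
    (a := ((2 * p - 2).choose (i + 1) : ZMod p))
    (b := ((2 * p - 2).choose (i + 1 + p - 1) : ZMod p))
    (c := ((2 * p - 2).choose i : ZMod p)) (d := ((2 * p - 2).choose (i + p - 1) : ZMod p))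
    ?_ ?_ ?_
  · rw [choose_two_mul_sub_two (k := i + 1) (by omega), choose_two_mul_sub_two (k := i) (by omega),
      choose_two_mul_sub_two_add (k := i + 1) (by omega),
      choose_two_mul_sub_two_add (k := i) (by omega)]
    simp only [pow_add, ZMod.pow_card, pow_one]
    push_cast
    have hsq : (-1 : ZMod p) ^ i * (-1) ^ i = 1 := by
      rw [← mul_pow]
      simp
    linear_combination -hsq
  · convert h₁ using 1
    rw [binomialPart, linForm_single_zero, add_mul, smul_mul_assoc, smul_mul_assoc,
      show 2 * p - 1 - (i + 1) = 2 * p - 2 - (i + 1) + 1 by omega,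
      show p - (i + 1) = p - 1 - (i + 1) + 1 by omega]
    congr 2 <;> ring
  · convert h₂ using 1
    rw [binomialPart, linForm_single_one, add_mul, smul_mul_assoc, smul_mul_assoc,
      show 2 * p - 1 - (i + 1) = 2 * p - 2 - i by omega,
      show p - (i + 1) = p - 1 - i by omega, show i + 1 + p - 1 = i + p - 1 + 1 by omega]
    congr 2 <;> ring

lemma Xr1Sub_two_mul_sub_one {p : ℕ} [hp : Fact p.Prime] :
    Xr1Sub p (2 * p - 1) = Vh p (2 * p - 1) := by
  have h2 := hp.out.two_le
  refine le_antisymm (Xr1Sub_le_Vh p _ (by omega)) ?_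
  rw [Vh_eq_span, Submodule.span_le]
  rintro _ ⟨⟨k, hk⟩, rfl⟩
  rw [SetLike.mem_coe]
  dsimp only
  rcases Nat.eq_zero_or_pos k with rfl | hk0
  · have h := linForm_pow_mul_mem_Xr1Sub p (2 * p - 1) ![1, 0] ![1, 0]
    rw [← pow_succ, linForm_single_zero, Nat.sub_add_cancel (by omega)] at h
    simpa using h
  rcases (show k ≤ 2 * p - 1 by omega).eq_or_lt with rfl | hk1
  · have h := linForm_pow_mul_mem_Xr1Sub p (2 * p - 1) ![0, 1] ![0, 1]
    rw [← pow_succ, linForm_single_one, Nat.sub_add_cancel (by omega)] at h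
    simpa using h
  rcases le_or_gt k (p - 1) with hkp | hkp
  · exact (X_pow_mul_X_pow_mem_Xr1Sub hk0 hkp).1
  · have h := (X_pow_mul_X_pow_mem_Xr1Sub (p := p) (k := k - (p - 1)) (by omega) (by omega)).2
    rwa [show p - (k - (p - 1)) = 2 * p - 1 - k by omega,
      show k - (p - 1) + p - 1 = k by omega] at h

/-! ### The exact sequence -/

/-- For a prime `p ≥ 3` and `r > p` with `r ≡ 1 mod (p−1)`, `r` not a power
of `p`, and `Σ_p(r−1) > p − 1`, there is a short exact sequence of `M`-equivariant maps
`0 → V_1 ⊗ D^{p−1} → X_{r−1} → V_{2p−1} → 0`. -/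
theorem Xr1_ses (p r : ℕ) (hp : p.Prime) (hp3 : 3 ≤ p) (hr : p < r)
    (hmod : r ≡ 1 [MOD p - 1]) (hnp : ∀ m : ℕ, r ≠ p ^ m)
    (hsig : p - 1 < (Nat.digits p (r - 1)).sum) :
    ∃ (ι : ↥(Vh p 1) →ₗ[ZMod p] ↥(Xr1Sub p r))
      (π : ↥(Xr1Sub p r) →ₗ[ZMod p] ↥(Vh p (2 * p - 1))),
      Function.Injective ι ∧ Function.Surjective π ∧
      LinearMap.ker π = LinearMap.range ι ∧
      EquivMap p (p - 1) 0 ι ∧ EquivMap p 0 0 π := by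
  have : Fact p.Prime := ⟨hp⟩
  have hN0 : 0 < r - 1 := by omega
  have hN : p - 1 ∣ r - 1 := (Nat.modEq_iff_dvd' (by omega)).1 hmod.symm
  have hchoose := exists_sub_one_dvd_not_dvd_choose hp hp3 hsig
  have hinj : Function.Injective (lineMap p (r - 1)) := by
    refine lineMap_injective hp3 ?_ hchoose
    rw [Nat.sub_add_cancel (by omega)]
    exact exists_sub_one_dvd_not_dvd_choose hp hp3 (sub_one_lt_digits_sum hp3 hmod (by omega) hnp)
  have hM0 : 0 < 2 * p - 2 := by omega
  have hM : p - 1 ∣ 2 * p - 2 := ⟨2, by omega⟩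
  have hker : ∀ f, orbitMap p (r - 1) f = 0 → orbitMap p (2 * p - 2) f = 0 := by
    intro f hf
    obtain ⟨x, hx⟩ := exists_lineMap_eq_orbitMap f
    rw [hx _ hN0 hN] at hf
    rw [hx _ hM0 hM, (map_eq_zero_iff _ hinj).1 hf, map_zero]
  have hrange : LinearMap.range (orbitMap p (r - 1)) ≤ LinearMap.range (lineMap p (r - 1)) := by
    rintro _ ⟨f, rfl⟩
    obtain ⟨x, hx⟩ := exists_lineMap_eq_orbitMap f
    exact ⟨x, (hx _ hN0 hN).symm⟩
  have hV : LinearMap.range (orbitMap p (2 * p - 2)) = Vh p (2 * p - 1) := by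
    rw [← Xr1Sub_two_mul_sub_one, Xr1Sub_eq_range, show 2 * p - 1 - 1 = 2 * p - 2 by omega]
  obtain ⟨s, hs⟩ := LinearMap.exists_rightInverse_of_surjective
    (orbitMap p (r - 1)).rangeRestrict (LinearMap.range_rangeRestrict _)
  have hX := Xr1Sub_eq_range p r
  have hsec : ∀ y : LinearMap.range (orbitMap p (r - 1)), orbitMap p (r - 1) (s y) = y :=
    fun y => congrArg Subtype.val (LinearMap.congr_fun hs y)
  let π : Xr1Sub p r →ₗ[ZMod p] Vh p (2 * p - 1) :=
    (orbitMap p (2 * p - 2) ∘ₗ s ∘ₗ Submodule.inclusion hX.le).codRestrict _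
      fun y => hV ▸ LinearMap.mem_range_self _ _
  have hπ : ∀ (y : Xr1Sub p r) f, orbitMap p (r - 1) f = y →
      (π y : MvPolynomial (Fin 2) (ZMod p)) = orbitMap p (2 * p - 2) f := by
    intro y f hf
    rw [← sub_eq_zero]
    change orbitMap p (2 * p - 2) (s (Submodule.inclusion hX.le y)) - _ = 0
    rw [← map_sub]
    refine hker _ ?_
    rw [map_sub, hsec, hf, Submodule.coe_inclusion, sub_self]
  have hlift : ∀ y : Xr1Sub p r, ∃ f, orbitMap p (r - 1) f = y := fun y => hX.le y.2
  have hπ_surj : Function.Surjective π := by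
    intro z
    obtain ⟨f, hf⟩ := hV.ge z.2
    refine ⟨⟨orbitMap p (r - 1) f, hX.ge ⟨f, rfl⟩⟩, Subtype.ext ?_⟩
    rw [hπ _ f rfl, hf]
  let ι : Vh p 1 →ₗ[ZMod p] Xr1Sub p r :=
    (LinearMap.mulLeft (ZMod p) (linFormSum p (r - 1))).restrict
      fun P hP => by
        obtain ⟨f, hf⟩ := exists_orbitMap_eq_linFormSum_mul p hP
        exact hX.ge ⟨f, hf _⟩
  have hι : ∀ P, (ι P : MvPolynomial (Fin 2) (ZMod p)) = linFormSum p (r - 1) * P := fun _ => rfl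
  have hι_inj : Function.Injective ι := by
    intro P Q h
    have h' := congrArg Subtype.val h
    rw [hι, hι] at h'
    exact Subtype.ext (mul_left_cancel₀ (linFormSum_ne_zero hN hchoose) h')
  have hle : LinearMap.range ι ≤ LinearMap.ker π := by
    rintro _ ⟨P, rfl⟩
    obtain ⟨f, hf⟩ := exists_orbitMap_eq_linFormSum_mul p P.2
    refine LinearMap.mem_ker.2 (Subtype.ext ?_)
    rw [hπ _ f (hf _), hf, linFormSum_two_mul_sub_two hp3, zero_mul, ZeroMemClass.coe_zero]
  refine ⟨ι, π, hι_inj, hπ_surj, ?_, ?_, ?_⟩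
  · have : Module.Finite (ZMod p) (Xr1Sub p r) :=
      Submodule.finiteDimensional_of_le (Xr1Sub_le_Vh p r (by omega))
    refine (Submodule.eq_of_le_of_finrank_le hle ?_).symm
    have h₁ := LinearMap.finrank_range_add_finrank_ker π
    rw [LinearMap.range_eq_top.2 hπ_surj, finrank_top, finrank_Vh] at h₁
    rw [LinearMap.finrank_range_of_inj hι_inj, finrank_Vh]
    have h₂ : Module.finrank (ZMod p) (Xr1Sub p r) ≤ (p + 1) * 2 := by
      rw [hX]
      refine (Submodule.finrank_mono hrange).trans ((LinearMap.finrank_range_le _).trans ?_)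
      simp [Module.finrank_pi_fintype, ZMod.card]
    omega
  · intro g P Q hPQ
    rw [hι, hι, hPQ, twAct, twAct, pow_zero, one_smul, map_mul]
    by_cases hg : g.det = 0
    · rw [matAct_linFormSum_of_det_eq_zero _ hg, hg, zero_pow (by omega), zero_smul, mul_zero,
        zero_mul]
    · rw [matAct_linFormSum_of_det_ne_zero _ hg, ZMod.pow_card_sub_one_eq_one hg, one_smul]
  · intro g x y hxy
    obtain ⟨f, hf⟩ := hlift x
    rw [twAct, pow_zero, one_smul] at hxy ⊢
    rw [hπ x f hf, ← orbitMap_mapDomain]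
    refine hπ y _ ?_
    rw [orbitMap_mapDomain, hf, hxy]
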